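/- arXiv:math/0510573 — 4 statements merged into one kernel-verified Lean document; each statement's English description precedes it below -/
import Mathlib

section
/- Let A be a real m×n matrix, let σ_1 ≥ σ_2 ≥ ... denote its singular values in decreasing order (with σ_q = 0 for q > rank A), and let k be an integer with 1 ≤ k ≤ min(m, n). Then for every orthonormal set of vectors x_1, ..., x_k in ℝ^m, one has ∑_{i=1}^k (Aᵀ x_i)ᵀ (Aᵀ x_i) ≤ ∑_{i=1}^k σ_i². -/
open Matrix BigOperators

/-- The columns of a matrix with orthonormal rows have Euclidean norm at most one. -/
lemma sum_sq_col_le_one_of_mul_transpose_eq_one {ι κ : Type*} [Fintype ι] [DecidableEq ι]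
    [Fintype κ] {C : Matrix ι κ ℝ} (hC : C * Cᵀ = 1) (j : κ) : ∑ i, C i j ^ 2 ≤ 1 := by
  have hP : (Cᵀ * C) * (Cᵀ * C) = Cᵀ * C := by
    rw [Matrix.mul_assoc, ← Matrix.mul_assoc C, hC, Matrix.one_mul]
  have hsymm : ∀ l, (Cᵀ * C) l j = (Cᵀ * C) j l := fun l => by
    simp only [Matrix.mul_apply, Matrix.transpose_apply, mul_comm]
  have hdiag : ∑ i, C i j ^ 2 = (Cᵀ * C) j j := by
    simp [Matrix.mul_apply, sq]
  have hself : ∑ l, (Cᵀ * C) j l ^ 2 = (Cᵀ * C) j j := by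
    conv_rhs => rw [← hP, Matrix.mul_apply]
    exact Finset.sum_congr rfl fun l _ => by rw [hsymm, sq]
  have hle : (Cᵀ * C) j j ^ 2 ≤ ∑ l, (Cᵀ * C) j l ^ 2 :=
    Finset.single_le_sum (f := fun l => (Cᵀ * C) j l ^ 2) (fun l _ => sq_nonneg _)
      (Finset.mem_univ j)
  rw [hdiag]
  nlinarith

/-- A sum of a decreasing sequence with weights in `[0, 1]` of total mass `k` is at most the sum
of its first `k` terms. -/
lemma Antitone.sum_mul_le_sum_castLE {m k : ℕ} (hk1 : 1 ≤ k) (hkm : k ≤ m) {mu w : Fin m → ℝ}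
    (hmu : Antitone mu) (hw0 : ∀ j, 0 ≤ w j) (hw1 : ∀ j, w j ≤ 1) (hw : ∑ j, w j = k) :
    ∑ j, mu j * w j ≤ ∑ i : Fin k, mu (Fin.castLE hkm i) := by
  set t := mu ⟨k - 1, by omega⟩ with ht
  have hterm : ∀ j : Fin m, (mu j - t) * w j ≤ if (j : ℕ) < k then mu j - t else 0 := by
    intro j
    split_ifs with hj
    · have : t ≤ mu j := hmu (Fin.le_def.2 (by simp only; omega))
      nlinarith [hw1 j]
    · have : mu j ≤ t := hmu (Fin.le_def.2 (by simp only; omega))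
      nlinarith [hw0 j]
  have hsum : ∑ j : Fin m, (if (j : ℕ) < k then mu j - t else 0) =
      ∑ i : Fin k, (mu (Fin.castLE hkm i) - t) := by
    clear_value t
    obtain ⟨d, rfl⟩ := Nat.exists_eq_add_of_le hkm
    rw [Fin.sum_univ_add]
    simp [Fin.castAdd]
  have hle := (Finset.sum_le_sum fun j (_ : j ∈ Finset.univ) => hterm j).trans_eq hsum
  simp only [sub_mul, Finset.sum_sub_distrib, ← Finset.mul_sum, hw, Finset.sum_const,
    Finset.card_univ, Fintype.card_fin, nsmul_eq_mul] at hle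
  linarith

/-- For a real `m × n` matrix `A` with singular values `σ 0 ≥ σ 1 ≥ ...`
(the nonnegative square roots of the eigenvalues `μ` of `A Aᵀ`, arranged decreasingly,
with `σ q = 0` for `q > rank A`), any `1 ≤ k ≤ min m n` and any orthonormal set
`x 1, ..., x k` in `ℝ^m`: `∑_{i<k} (Aᵀ xᵢ)ᵀ (Aᵀ xᵢ) ≤ ∑_{i<k} σᵢ²`. -/
theorem singular_value_bound_left (m n k : ℕ) (hk1 : 1 ≤ k) (hk : k ≤ min m n)
    (A : Matrix (Fin m) (Fin n) ℝ)
    (mu : Fin m → ℝ) (hmu : Antitone mu)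
    (u : Fin m → Fin m → ℝ)
    (hu : ∀ i j, u i ⬝ᵥ u j = if i = j then (1 : ℝ) else 0)
    (hueig : ∀ i, (A * Aᵀ).mulVec (u i) = mu i • u i)
    (σ : Fin m → ℝ) (hσnonneg : ∀ i, 0 ≤ σ i) (hσsq : ∀ i, σ i ^ 2 = mu i)
    (x : Fin k → Fin m → ℝ)
    (hx : ∀ i j, x i ⬝ᵥ x j = if i = j then (1 : ℝ) else 0) :
    ∑ i : Fin k, (Aᵀ.mulVec (x i)) ⬝ᵥ (Aᵀ.mulVec (x i)) ≤
      ∑ i : Fin k, σ (Fin.castLE (hk.trans (min_le_left m n)) i) ^ 2 := by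
  have hUU : Matrix.of u * (Matrix.of u)ᵀ = 1 := by
    ext i j
    simpa [Matrix.mul_apply, Matrix.one_apply, dotProduct] using hu i j
  have hUU' : (Matrix.of u)ᵀ * Matrix.of u = 1 := mul_eq_one_comm.1 hUU
  have hXX : Matrix.of x * (Matrix.of x)ᵀ = 1 := by
    ext i j
    simpa [Matrix.mul_apply, Matrix.one_apply, dotProduct] using hx i j
  have heig : A * Aᵀ * (Matrix.of u)ᵀ = (Matrix.of u)ᵀ * Matrix.diagonal mu := by
    ext i j
    rw [Matrix.mul_diagonal]
    simpa [Matrix.mul_apply, Matrix.mulVec, dotProduct, mul_comm] using congrFun (hueig j) i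
  have hspec : A * Aᵀ = (Matrix.of u)ᵀ * Matrix.diagonal mu * Matrix.of u := by
    rw [← heig, Matrix.mul_assoc, hUU', Matrix.mul_one]
  set C := Matrix.of x * (Matrix.of u)ᵀ with hCdef
  have hCC : C * Cᵀ = 1 := by
    rw [hCdef, Matrix.transpose_mul, Matrix.transpose_transpose, Matrix.mul_assoc,
      ← Matrix.mul_assoc _ (Matrix.of u), hUU', Matrix.one_mul, hXX]
  have hquad : Matrix.of x * A * (Matrix.of x * A)ᵀ = C * Matrix.diagonal mu * Cᵀ := by
    rw [Matrix.transpose_mul, Matrix.mul_assoc, ← Matrix.mul_assoc A, hspec, hCdef,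
      Matrix.transpose_mul, Matrix.transpose_transpose]
    simp only [Matrix.mul_assoc]
  have hrow : ∀ i, Aᵀ.mulVec (x i) ⬝ᵥ Aᵀ.mulVec (x i) = ∑ j, mu j * C i j ^ 2 := by
    intro i
    calc Aᵀ.mulVec (x i) ⬝ᵥ Aᵀ.mulVec (x i)
        = (Matrix.of x * A * (Matrix.of x * A)ᵀ) i i := by
          simp [Matrix.mul_apply, Matrix.mulVec, dotProduct, mul_comm]
      _ = ∑ j, mu j * C i j ^ 2 := by
          rw [hquad, Matrix.mul_apply]
          refine Finset.sum_congr rfl fun j _ => ?_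
          rw [Matrix.mul_diagonal, Matrix.transpose_apply]
          ring
  have hmass : ∑ j, ∑ i, C i j ^ 2 = k := by
    rw [Finset.sum_comm]
    have hone : ∀ i, ∑ j, C i j ^ 2 = 1 := fun i => by
      simpa [Matrix.mul_apply, sq] using congrFun (congrFun hCC i) i
    simp [hone]
  simp only [hrow, hσsq]
  rw [Finset.sum_comm]
  simp only [← Finset.mul_sum]
  exact hmu.sum_mul_le_sum_castLE hk1 _ (fun j => Finset.sum_nonneg fun i _ => sq_nonneg _)
    (sum_sq_col_le_one_of_mul_transpose_eq_one hCC) hmass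
end

section
/- Let A be a real m×n matrix of rank r with singular value decomposition A = ∑_{q=1}^r σ_q u_q v_qᵀ, where σ_1 ≥ ... ≥ σ_r > 0 are the singular values and u_1, ..., u_r ∈ ℝ^m, v_1, ..., v_r ∈ ℝ^n are orthonormal systems of left and right singular vectors. Then for every integer k with 1 ≤ k ≤ r, min over all m×n real matrices B of rank at most k of ‖A − B‖_F equals ‖A − ∑_{q=1}^k σ_q u_q v_qᵀ‖_F = √(∑_{q=k+1}^r σ_q²). -/
open Matrix BigOperators

/-- The Frobenius norm of a real matrix: `‖M‖_F = √(trace (Mᵀ M))`. -/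
noncomputable def frobNorm {m n : ℕ} (M : Matrix (Fin m) (Fin n) ℝ) : ℝ :=
  Real.sqrt (Matrix.trace (Mᵀ * M))

theorem dotProduct_self_sum_smul_of_orthonormal {ι κ : Type*} [Fintype ι] [DecidableEq κ]
    {v : κ → ι → ℝ} (hv : ∀ i j, v i ⬝ᵥ v j = if i = j then (1 : ℝ) else 0)
    (s : Finset κ) (α : κ → ℝ) :
    (∑ q ∈ s, α q • v q) ⬝ᵥ (∑ q ∈ s, α q • v q) = ∑ q ∈ s, α q ^ 2 := by
  simp only [sum_dotProduct, dotProduct_sum, smul_dotProduct, dotProduct_smul, hv, smul_eq_mul,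
    mul_ite, mul_one, mul_zero]
  refine Finset.sum_congr rfl fun q hq => ?_
  rw [Finset.sum_ite_eq' s q]
  simp [hq, sq]

theorem trace_transpose_mul_self_sum_smul_vecMulVec {ι ι' κ : Type*} [Fintype ι] [Fintype ι']
    [DecidableEq κ] {u : κ → ι → ℝ} {v : κ → ι' → ℝ}
    (hu : ∀ i j, u i ⬝ᵥ u j = if i = j then (1 : ℝ) else 0)
    (hv : ∀ i j, v i ⬝ᵥ v j = if i = j then (1 : ℝ) else 0)
    (s : Finset κ) (σ : κ → ℝ) :
    trace ((∑ q ∈ s, σ q • vecMulVec (u q) (v q))ᵀ * ∑ q ∈ s, σ q • vecMulVec (u q) (v q)) =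
      ∑ q ∈ s, σ q ^ 2 := by
  simp only [transpose_sum, transpose_smul, transpose_vecMulVec, Matrix.sum_mul, Matrix.mul_sum,
    trace_sum, Matrix.smul_mul, Matrix.mul_smul, trace_smul, vecMulVec_mul_vecMulVec, trace_vecMulVec,
    dotProduct_smul, hu, hv, smul_eq_mul]
  refine Finset.sum_congr rfl fun q hq => ?_
  rw [Finset.sum_eq_single q] <;> simp +contextual [hq, sq, eq_comm]

theorem rank_sum_smul_vecMulVec_le {ι ι' κ : Type*} [Fintype ι] [Fintype ι']
    (u : κ → ι → ℝ) (v : κ → ι' → ℝ) (σ : κ → ℝ) (s : Finset κ) :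
    (∑ q ∈ s, σ q • vecMulVec (u q) (v q)).rank ≤ s.card := by
  have h : ∑ q ∈ s, σ q • vecMulVec (u q) (v q) =
      (of fun i (q : s) => σ q * u q i) * of fun (q : s) j => v q j := by
    ext i j
    simp only [Matrix.sum_apply, Matrix.smul_apply, vecMulVec_apply, smul_eq_mul, mul_apply, of_apply,
      ← mul_assoc]
    exact (Finset.sum_coe_sort s fun q => σ q * u q i * v q j).symm
  rw [h]
  exact ((rank_mul_le_left _ _).trans (rank_le_card_width _)).trans_eq (Fintype.card_coe s)

theorem sum_mul_le_sum_filter_lt_of_antitone {r k : ℕ} (hk1 : 1 ≤ k) (hkr : k ≤ r)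
    {s c : Fin r → ℝ} (hs : Antitone s) (hs0 : ∀ q, 0 ≤ s q) (hc0 : ∀ q, 0 ≤ c q)
    (hc1 : ∀ q, c q ≤ 1) (hck : ∑ q, c q ≤ k) :
    ∑ q, s q * c q ≤ ∑ q ∈ Finset.univ.filter (fun q : Fin r => (q : ℕ) < k), s q := by
  obtain ⟨p, hp⟩ : ∃ p : Fin r, (p : ℕ) + 1 = k := ⟨⟨k - 1, by omega⟩, by simp; omega⟩
  have hcard : ∑ q : Fin r, (if (q : ℕ) < k then (1 : ℝ) else 0) = k := by
    simp [Fin.card_filter_val_lt, hkr]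
  have hle : ∀ q, s q * c q ≤
      s q * (if (q : ℕ) < k then 1 else 0) - s p * ((if (q : ℕ) < k then 1 else 0) - c q) := by
    intro q
    split_ifs with h
    · have := hs (show q ≤ p from by rw [Fin.le_def]; omega)
      nlinarith [hc1 q]
    · have := hs (show p ≤ q from by rw [Fin.le_def]; omega)
      nlinarith [hc0 q]
  calc ∑ q, s q * c q ≤ _ := Finset.sum_le_sum fun q _ => hle q
    _ = (∑ q, s q * (if (q : ℕ) < k then 1 else 0)) - s p * (k - ∑ q, c q) := by
      rw [Finset.sum_sub_distrib, ← Finset.mul_sum, Finset.sum_sub_distrib, hcard]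
    _ ≤ ∑ q, s q * (if (q : ℕ) < k then 1 else 0) :=
      sub_le_self _ (mul_nonneg (hs0 p) (sub_nonneg.2 hck))
    _ = _ := by simp [Finset.sum_filter]

theorem norm_sq_sub_sum_inner_sq_le {E ι : Type*} [NormedAddCommGroup E] [InnerProductSpace ℝ E]
    [Fintype ι] {W : Submodule ℝ E} (b : OrthonormalBasis ι ℝ W) (a : E) {y : E} (hy : y ∈ W) :
    ‖a‖ ^ 2 - ∑ i, inner ℝ (b i : E) a ^ 2 ≤ ‖a - y‖ ^ 2 := by
  have hsum : ∑ i, inner ℝ (b i : E) y • (b i : E) = y := by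
    simpa using congrArg (Subtype.val : W → E) (b.sum_repr' ⟨y, hy⟩)
  have hinner : ∀ x : E, inner ℝ x y = ∑ i, inner ℝ (b i : E) x * inner ℝ (b i : E) y := by
    intro x
    conv_lhs => rw [← hsum]
    rw [inner_sum]
    refine Finset.sum_congr rfl fun i _ => ?_
    rw [real_inner_smul_right, real_inner_comm x, mul_comm]
  have hpos : 0 ≤ ∑ i, (inner ℝ (b i : E) a - inner ℝ (b i : E) y) ^ 2 :=
    Finset.sum_nonneg fun i _ => sq_nonneg _
  have hexp : ∑ i, (inner ℝ (b i : E) a - inner ℝ (b i : E) y) ^ 2 =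
      ∑ i, inner ℝ (b i : E) a ^ 2 - 2 * inner ℝ a y + inner ℝ y y := by
    rw [hinner a, hinner y, Finset.mul_sum, ← Finset.sum_sub_distrib, ← Finset.sum_add_distrib]
    exact Finset.sum_congr rfl fun i _ => by ring
  rw [norm_sub_sq_real, ← real_inner_self_eq_norm_sq y]
  linarith

theorem trace_transpose_mul_self_eq_sum_norm_sq {ι ι' : Type*} [Fintype ι] [Fintype ι']
    (M : Matrix ι ι' ℝ) : trace (Mᵀ * M) = ∑ j, ‖WithLp.toLp 2 (M.col j)‖ ^ 2 := by
  simp [trace, mul_apply, EuclideanSpace.norm_sq_eq, ← sq]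

theorem sum_sq_le_trace_transpose_mul_self_sub {m n r k : ℕ}
    {σ : Fin r → ℝ} (hσpos : ∀ q, 0 < σ q) (hσmono : Antitone σ)
    {u : Fin r → Fin m → ℝ} {v : Fin r → Fin n → ℝ}
    (hu : ∀ i j, u i ⬝ᵥ u j = if i = j then (1 : ℝ) else 0)
    (hv : ∀ i j, v i ⬝ᵥ v j = if i = j then (1 : ℝ) else 0)
    (hk1 : 1 ≤ k) (hkr : k ≤ r) {B : Matrix (Fin m) (Fin n) ℝ} (hB : B.rank ≤ k) :
    ∑ q ∈ Finset.univ.filter (fun q : Fin r => k ≤ (q : ℕ)), σ q ^ 2 ≤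
      trace ((∑ q, σ q • vecMulVec (u q) (v q) - B)ᵀ *
        (∑ q, σ q • vecMulVec (u q) (v q) - B)) := by
  set A := ∑ q, σ q • vecMulVec (u q) (v q) with hA
  let W : Submodule ℝ (EuclideanSpace ℝ (Fin m)) := LinearMap.range (toEuclideanLin B)
  let b := stdOrthonormalBasis ℝ W
  let U : Fin r → EuclideanSpace ℝ (Fin m) := fun q => WithLp.toLp 2 (u q)
  have hW : Module.finrank ℝ W ≤ k := by
    rwa [rank_eq_finrank_range_toLin B (PiLp.basisFun 2 ℝ (Fin m)) (PiLp.basisFun 2 ℝ (Fin n)),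
      ← toLpLin_eq_toLin] at hB
  have hU : Orthonormal ℝ U := by
    rw [orthonormal_iff_ite]
    intro i j
    simp [U, EuclideanSpace.inner_eq_star_dotProduct, hu, eq_comm]
  have hb : Orthonormal ℝ (fun i => (b i : EuclideanSpace ℝ (Fin m))) :=
    b.orthonormal.comp_linearIsometry W.subtypeₗᵢ
  let c : Fin r → ℝ := fun q => ∑ i, inner ℝ (b i : EuclideanSpace ℝ (Fin m)) (U q) ^ 2
  have hc1 : ∀ q, c q ≤ 1 := fun q => by
    simpa [hU.1 q] using hb.sum_inner_products_le (U q) (s := Finset.univ)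
  have hck : ∑ q, c q ≤ k := by
    calc ∑ q, c q = ∑ i, ∑ q, inner ℝ (b i : EuclideanSpace ℝ (Fin m)) (U q) ^ 2 :=
          Finset.sum_comm
      _ ≤ ∑ i : Fin (Module.finrank ℝ W), (1 : ℝ) := by
        refine Finset.sum_le_sum fun i _ => ?_
        have h := hU.sum_inner_products_le (b i : EuclideanSpace ℝ (Fin m)) (s := Finset.univ)
        have hi : ‖(b i : EuclideanSpace ℝ (Fin m))‖ = 1 := hb.1 i
        simpa [hi, real_inner_comm] using h
      _ ≤ k := by simpa using hW
  have hcol : ∀ j, WithLp.toLp 2 (A.col j) = ∑ q, (σ q * v q j) • U q := by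
    intro j
    ext i
    simp [hA, U, Matrix.sum_apply, vecMulVec_apply, mul_assoc, mul_comm (u _ _)]
  have hinner : ∀ w : EuclideanSpace ℝ (Fin m),
      ∑ j, inner ℝ w (WithLp.toLp 2 (A.col j)) ^ 2 = ∑ q, σ q ^ 2 * inner ℝ w (U q) ^ 2 := by
    intro w
    have h := dotProduct_self_sum_smul_of_orthonormal hv Finset.univ
      (fun q => σ q * inner ℝ w (U q))
    simp only [mul_pow] at h
    rw [← h]
    simp only [dotProduct, hcol, inner_sum, real_inner_smul_right, Finset.sum_apply,
      Pi.smul_apply, smul_eq_mul, ← sq]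
    refine Finset.sum_congr rfl fun j _ => congrArg (· ^ 2) (Finset.sum_congr rfl fun q _ => ?_)
    ring
  have hcolB : ∀ j, WithLp.toLp 2 (B.col j) ∈ W := fun j =>
    ⟨EuclideanSpace.single j 1, by ext i; simp [toLpLin_apply]⟩
  have hlower : trace (Aᵀ * A) - ∑ q, σ q ^ 2 * c q ≤ trace ((A - B)ᵀ * (A - B)) := by
    have hswap : ∑ q, σ q ^ 2 * c q = ∑ j, ∑ i,
        inner ℝ (b i : EuclideanSpace ℝ (Fin m)) (WithLp.toLp 2 (A.col j)) ^ 2 := by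
      rw [Finset.sum_comm]
      simp only [hinner, c, Finset.mul_sum]
      exact Finset.sum_comm
    rw [hswap, trace_transpose_mul_self_eq_sum_norm_sq, trace_transpose_mul_self_eq_sum_norm_sq,
      ← Finset.sum_sub_distrib]
    refine Finset.sum_le_sum fun j _ => ?_
    have hsub : WithLp.toLp 2 ((A - B).col j) = WithLp.toLp 2 (A.col j) - WithLp.toLp 2 (B.col j) :=
      rfl
    rw [hsub]
    exact norm_sq_sub_sum_inner_sq_le b _ (hcolB j)
  have hopt := sum_mul_le_sum_filter_lt_of_antitone hk1 hkr (s := fun q => σ q ^ 2) (c := c)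
    (fun p q h => pow_le_pow_left₀ (hσpos q).le (hσmono h) 2) (fun q => sq_nonneg _)
    (fun q => Finset.sum_nonneg fun i _ => sq_nonneg _) hc1 hck
  have hsplit := Finset.sum_filter_add_sum_filter_not Finset.univ
    (fun q : Fin r => (q : ℕ) < k) (fun q => σ q ^ 2)
  simp only [not_lt] at hsplit
  have htr : trace (Aᵀ * A) = ∑ q, σ q ^ 2 :=
    trace_transpose_mul_self_sum_smul_vecMulVec hu hv Finset.univ σ
  linarith

/-- Eckart–Young: if `A = ∑_{q<r} σ q • u q (v q)ᵀ` is a singular value decomposition of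
the rank-`r` matrix `A` (`σ 0 ≥ ... ≥ σ (r-1) > 0`, `u`, `v` orthonormal,
`A v q = σ q u q`, `Aᵀ u q = σ q v q`), then for `1 ≤ k ≤ r` the truncation
`∑_{q<k} σ q • u q (v q)ᵀ` minimizes `‖A − B‖_F` over all matrices `B` of rank at most
`k`, and the minimal value equals `√(∑_{q≥k} σ q ²)`. -/
theorem eckart_young_min (m n r k : ℕ)
    (A : Matrix (Fin m) (Fin n) ℝ) (hrank : A.rank = r)
    (σ : Fin r → ℝ) (hσpos : ∀ q, 0 < σ q) (hσmono : Antitone σ)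
    (u : Fin r → Fin m → ℝ) (v : Fin r → Fin n → ℝ)
    (hu : ∀ i j, u i ⬝ᵥ u j = if i = j then (1 : ℝ) else 0)
    (hv : ∀ i j, v i ⬝ᵥ v j = if i = j then (1 : ℝ) else 0)
    (hAv : ∀ q, A.mulVec (v q) = σ q • u q)
    (hAu : ∀ q, Aᵀ.mulVec (u q) = σ q • v q)
    (hA : A = ∑ q : Fin r, σ q • vecMulVec (u q) (v q))
    (hk1 : 1 ≤ k) (hkr : k ≤ r) :
    IsLeast
      {e : ℝ | ∃ B : Matrix (Fin m) (Fin n) ℝ, B.rank ≤ k ∧ e = frobNorm (A - B)}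
      (frobNorm (A - ∑ q ∈ Finset.univ.filter (fun q : Fin r => (q : ℕ) < k),
        σ q • vecMulVec (u q) (v q))) ∧
    frobNorm (A - ∑ q ∈ Finset.univ.filter (fun q : Fin r => (q : ℕ) < k),
        σ q • vecMulVec (u q) (v q)) =
      Real.sqrt (∑ q ∈ Finset.univ.filter (fun q : Fin r => k ≤ (q : ℕ)), σ q ^ 2) := by
  have htail : A - ∑ q ∈ Finset.univ.filter (fun q : Fin r => (q : ℕ) < k),
      σ q • vecMulVec (u q) (v q) =
      ∑ q ∈ Finset.univ.filter (fun q : Fin r => k ≤ (q : ℕ)), σ q • vecMulVec (u q) (v q) := by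
    rw [hA, sub_eq_iff_eq_add', ← Finset.sum_filter_add_sum_filter_not Finset.univ
      (fun q : Fin r => (q : ℕ) < k)]
    simp only [not_lt]
  have hval : frobNorm (A - ∑ q ∈ Finset.univ.filter (fun q : Fin r => (q : ℕ) < k),
      σ q • vecMulVec (u q) (v q)) =
      Real.sqrt (∑ q ∈ Finset.univ.filter (fun q : Fin r => k ≤ (q : ℕ)), σ q ^ 2) := by
    rw [htail, frobNorm, trace_transpose_mul_self_sum_smul_vecMulVec hu hv]
  refine ⟨⟨⟨_, (rank_sum_smul_vecMulVec_le u v σ _).trans ?_, rfl⟩, ?_⟩, hval⟩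
  · simp [Fin.card_filter_val_lt]
  · rintro e ⟨B, hB, rfl⟩
    rw [hval, frobNorm, hA]
    exact Real.sqrt_le_sqrt
      (sum_sq_le_trace_transpose_mul_self_sub hσpos hσmono hu hv hk1 hkr hB)
end

section
/- Let A be a real m×n matrix of rank r with singular value decomposition A = ∑_{q=1}^r σ_q u_q v_qᵀ (σ_1 ≥ ... ≥ σ_r > 0, u_q and v_q orthonormal left and right singular vectors), let 1 ≤ k < r, and suppose σ_k > σ_{k+1}. Then ∑_{q=1}^k σ_q u_q v_qᵀ is the unique matrix B of rank at most k minimizing ‖A − B‖_F; i.e., any m×n matrix B with rank B ≤ k and ‖A − B‖_F = √(∑_{q=k+1}^r σ_q²) equals ∑_{q=1}^k σ_q u_q v_qᵀ. -/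
open Matrix BigOperators

/-- The row space of a real matrix has an orthogonal projection, whose trace is the rank. -/
theorem Matrix.exists_rowSpace_projection {m n : ℕ} (B : Matrix (Fin m) (Fin n) ℝ) :
    ∃ P : Matrix (Fin n) (Fin n) ℝ, Pᵀ = P ∧ P * P = P ∧ B * P = B ∧ P.trace = B.rank := by
  have hS : (Bᵀ * B).IsHermitian := by
    simpa using isHermitian_conjTranspose_mul_self B
  set U : Matrix (Fin n) (Fin n) ℝ := (hS.eigenvectorUnitary : Matrix (Fin n) (Fin n) ℝ) with hU
  have hUU : Uᵀ * U = 1 := by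
    have := Unitary.coe_star_mul_self hS.eigenvectorUnitary
    simpa [star_eq_conjTranspose] using this
  have hspec : Bᵀ * B = U * diagonal hS.eigenvalues * Uᵀ := by
    have := hS.spectral_theorem
    rw [Unitary.conjStarAlgAut_apply] at this
    simpa [star_eq_conjTranspose, Function.comp_def] using this
  set d : Fin n → ℝ := fun i => if hS.eigenvalues i ≠ 0 then 1 else 0 with hd
  refine ⟨U * diagonal d * Uᵀ, ?_, ?_, ?_, ?_⟩
  · simp [Matrix.mul_assoc]
  · calc U * diagonal d * Uᵀ * (U * diagonal d * Uᵀ)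
        = U * diagonal d * (Uᵀ * U) * diagonal d * Uᵀ := by simp only [Matrix.mul_assoc]
      _ = U * (diagonal d * diagonal d) * Uᵀ := by
        rw [hUU, Matrix.mul_one, Matrix.mul_assoc U]
      _ = U * diagonal d * Uᵀ := by
        rw [diagonal_mul_diagonal]
        congr 3
        ext i
        simp [hd]
  · have h : Bᵀ * B * (1 - U * diagonal d * Uᵀ) = 0 := by
      rw [Matrix.mul_sub, Matrix.mul_one, sub_eq_zero]
      calc Bᵀ * B = U * (diagonal hS.eigenvalues * diagonal d) * Uᵀ := by
            rw [diagonal_mul_diagonal]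
            refine hspec.trans ?_
            congr 3
            ext i
            by_cases hi : hS.eigenvalues i = 0 <;> simp [hd, hi]
        _ = U * diagonal hS.eigenvalues * (Uᵀ * U) * diagonal d * Uᵀ := by
            rw [hUU, Matrix.mul_one, ← Matrix.mul_assoc U]
        _ = U * diagonal hS.eigenvalues * Uᵀ * (U * diagonal d * Uᵀ) := by
            simp only [Matrix.mul_assoc]
        _ = Bᵀ * B * (U * diagonal d * Uᵀ) := congrArg (· * _) hspec.symm
    have h' : B * (1 - U * diagonal d * Uᵀ) = 0 := by
      rw [← conjTranspose_mul_self_mul_eq_zero]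
      simpa using h
    rw [Matrix.mul_sub, Matrix.mul_one, sub_eq_zero] at h'
    exact h'.symm
  · rw [Matrix.trace_mul_comm, ← Matrix.mul_assoc, hUU, Matrix.one_mul, trace_diagonal,
      ← rank_transpose_mul_self B, hS.rank_eq_card_non_zero_eigs, Fintype.card_subtype]
    simp [hd, Finset.sum_ite]

theorem Matrix.trace_transpose_mul_self_nonneg {m n : ℕ} (M : Matrix (Fin m) (Fin n) ℝ) :
    0 ≤ (Mᵀ * M).trace := by
  simpa using (posSemidef_conjTranspose_mul_self M).trace_nonneg

theorem Matrix.trace_transpose_mul_self_eq_zero {m n : ℕ} {M : Matrix (Fin m) (Fin n) ℝ}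
    (h : (Mᵀ * M).trace = 0) : M = 0 := by
  rw [← trace_conjTranspose_mul_self_eq_zero_iff]
  simpa using h

/-- The compression of an orthogonal projection to an orthonormal family has trace at most that
of the projection. -/
theorem Matrix.sum_dotProduct_mulVec_le_trace {n r : ℕ} {P : Matrix (Fin n) (Fin n) ℝ}
    (hPt : Pᵀ = P) (hPP : P * P = P) (v : Fin r → Fin n → ℝ)
    (hv : ∀ i j, v i ⬝ᵥ v j = if i = j then (1 : ℝ) else 0) :
    ∑ q, v q ⬝ᵥ P *ᵥ v q ≤ P.trace := by
  set V : Matrix (Fin r) (Fin n) ℝ := Matrix.of v with hV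
  have hVV : V * Vᵀ = 1 := by
    ext i j
    simpa [hV, mul_apply, dotProduct, one_apply] using hv i j
  have hsum : ∑ q, v q ⬝ᵥ P *ᵥ v q = (V * P * Vᵀ).trace := by
    rw [Matrix.mul_assoc]
    rfl
  have hT : (P * P - Vᵀ * V * P * P).trace = P.trace - (V * P * Vᵀ).trace := by
    rw [trace_sub, Matrix.mul_assoc (Vᵀ * V), hPP, Matrix.mul_assoc Vᵀ, trace_mul_comm Vᵀ]
  have hE : (((1 - Vᵀ * V) * P)ᵀ * ((1 - Vᵀ * V) * P)).trace
      = (P * P - Vᵀ * V * P * P).trace := by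
    have hQ : (1 - Vᵀ * V) * (1 - Vᵀ * V) = 1 - Vᵀ * V := by
      have : Vᵀ * V * (Vᵀ * V) = Vᵀ * V := by
        rw [Matrix.mul_assoc, ← Matrix.mul_assoc V, hVV, Matrix.one_mul]
      simp [Matrix.mul_sub, Matrix.sub_mul, this]
    have hQt : (1 - Vᵀ * V)ᵀ = 1 - Vᵀ * V := by simp
    rw [transpose_mul, hQt, hPt, Matrix.mul_assoc, ← Matrix.mul_assoc (1 - Vᵀ * V), hQ,
      trace_mul_comm, Matrix.sub_mul, Matrix.sub_mul, Matrix.one_mul]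
  have := trace_transpose_mul_self_nonneg ((1 - Vᵀ * V) * P)
  linarith

/-- The quadratic form of an orthogonal projection. -/
theorem Matrix.dotProduct_mulVec_of_projection {n : ℕ} {P : Matrix (Fin n) (Fin n) ℝ}
    (hPt : Pᵀ = P) (hPP : P * P = P) (x : Fin n → ℝ) :
    x ⬝ᵥ P *ᵥ x = P *ᵥ x ⬝ᵥ P *ᵥ x := by
  conv_lhs => rw [← hPP, ← mulVec_mulVec, dotProduct_mulVec, ← mulVec_transpose, hPt]

/-- Pythagoras for the Frobenius norm along a projection fixing the rows of `B`. -/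
theorem Matrix.trace_transpose_mul_self_sub {m n : ℕ} (A : Matrix (Fin m) (Fin n) ℝ)
    {B : Matrix (Fin m) (Fin n) ℝ} {P : Matrix (Fin n) (Fin n) ℝ}
    (hPt : Pᵀ = P) (hPP : P * P = P) (hBP : B * P = B) :
    ((A - B)ᵀ * (A - B)).trace
      = ((A * P - B)ᵀ * (A * P - B)).trace + (Aᵀ * A * (1 - P)).trace := by
  have hPB : P * Bᵀ = Bᵀ := by
    rw [← hPt, ← transpose_mul, hBP]
  have h1 : (Bᵀ * A * P).trace = (Bᵀ * A).trace := by
    rw [trace_mul_comm, ← Matrix.mul_assoc, hPB]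
  have h2 : (P * Aᵀ * B).trace = (Aᵀ * B).trace := by
    rw [Matrix.mul_assoc, trace_mul_comm, Matrix.mul_assoc, hBP]
  have h3 : (P * Aᵀ * (A * P)).trace = (Aᵀ * A * P).trace := by
    rw [Matrix.mul_assoc, trace_mul_comm, ← Matrix.mul_assoc, Matrix.mul_assoc _ P P, hPP]
  simp only [transpose_sub, transpose_mul, hPt, Matrix.mul_sub, Matrix.sub_mul, trace_sub,
    Matrix.mul_one]
  rw [h2, h3, ← Matrix.mul_assoc, h1]
  ring

/-- Among weights in `[0, 1]` of total mass at most `k`, only the indicator of the first `k`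
indices can capture as much of a sequence `s` with a gap after its first `k` terms. -/
theorem weights_eq_indicator_of_gap {r k : ℕ} (hkr : k ≤ r) {s c : Fin r → ℝ} {t : ℝ} (ht : 0 < t)
    (hlow : ∀ q : Fin r, (q : ℕ) < k → t < s q) (hhigh : ∀ q : Fin r, k ≤ (q : ℕ) → s q ≤ t)
    (hc0 : ∀ q, 0 ≤ c q) (hc1 : ∀ q, c q ≤ 1) (hc : ∑ q, c q ≤ k)
    {e : ℝ} (he : 0 ≤ e)
    (h : ∑ q ∈ Finset.univ.filter (fun q : Fin r => k ≤ (q : ℕ)), s q = e + ∑ q, s q * (1 - c q)) :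
    e = 0 ∧ ∀ q : Fin r, c q = if (q : ℕ) < k then 1 else 0 := by
  set g : Fin r → ℝ := fun q => if (q : ℕ) < k then 1 else 0 with hg
  have hgsum : ∑ q, g q = k := by
    have : (Finset.univ.filter fun q : Fin r => (q : ℕ) < k).card = k := by
      rw [Fin.card_filter_val_lt, min_eq_right hkr]
    simp [hg, this]
  have htail : ∑ q ∈ Finset.univ.filter (fun q : Fin r => k ≤ (q : ℕ)), s q
      = ∑ q, s q * (1 - g q) := by
    rw [Finset.sum_filter]
    refine Finset.sum_congr rfl fun q _ => ?_
    by_cases hq : (q : ℕ) < k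
    · simp [hg, hq]
    · simp [hg, hq, not_lt.mp hq]
  have hterm : ∀ q, 0 ≤ (s q - t) * (g q - c q) := by
    intro q
    by_cases hq : (q : ℕ) < k
    · simpa [hg, hq] using mul_nonneg (sub_nonneg.2 (hlow q hq).le) (sub_nonneg.2 (hc1 q))
    · have := mul_nonneg (sub_nonneg.2 (hhigh q (not_lt.1 hq))) (hc0 q)
      simp only [hg, hq, if_false]
      linarith
  have hident : ∑ q, (s q - t) * (g q - c q) + t * (k - ∑ q, c q) + e = 0 := by
    rw [htail] at h
    rw [← hgsum, ← Finset.sum_sub_distrib, Finset.mul_sum, ← Finset.sum_add_distrib]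
    have : ∑ q, ((s q - t) * (g q - c q) + t * (g q - c q))
        = ∑ q, s q * (1 - c q) - ∑ q, s q * (1 - g q) := by
      rw [← Finset.sum_sub_distrib]
      exact Finset.sum_congr rfl fun q _ => by ring
    rw [this]
    linarith
  have hS := Finset.sum_nonneg fun q (_ : q ∈ Finset.univ) => hterm q
  have hM : 0 ≤ t * (k - ∑ q, c q) := mul_nonneg ht.le (sub_nonneg.2 hc)
  have hS0 : ∑ q, (s q - t) * (g q - c q) = 0 := by linarith
  have hM0 : t * (k - ∑ q, c q) = 0 := by linarith
  have hck : ∑ q, c q = k := by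
    have := (mul_eq_zero.1 hM0).resolve_left ht.ne'
    linarith
  have hone : ∀ q : Fin r, (q : ℕ) < k → c q = 1 := by
    intro q hq
    have h0 := (Finset.sum_eq_zero_iff_of_nonneg fun q _ => hterm q).1 hS0 q (Finset.mem_univ q)
    have := (mul_eq_zero.1 h0).resolve_left (sub_pos.2 (hlow q hq)).ne'
    simp only [hg, hq, if_true] at this
    linarith
  have hge : ∀ q ∈ Finset.univ, g q ≤ c q := by
    intro q _
    by_cases hq : (q : ℕ) < k
    · simp [hg, hq, hone q hq]
    · simpa [hg, hq] using hc0 q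
  refine ⟨by linarith, fun q => ?_⟩
  exact ((Finset.sum_eq_sum_iff_of_le hge).1 (hgsum.trans hck.symm) q (Finset.mem_univ q)).symm

/-- Uniqueness in Eckart–Young: if `A = ∑_{q<r} σ q • u q (v q)ᵀ` is a singular value
decomposition of the rank-`r` matrix `A`, `1 ≤ k < r` and `σ_k > σ_{k+1}` (0-indexed:
`σ (k-1) > σ k`), then any `B` of rank at most `k` with
`‖A − B‖_F = √(∑_{q≥k} σ q ²)` equals the truncation `∑_{q<k} σ q • u q (v q)ᵀ`. -/
theorem eckart_young_unique (m n r k : ℕ)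
    (A : Matrix (Fin m) (Fin n) ℝ) (hrank : A.rank = r)
    (σ : Fin r → ℝ) (hσpos : ∀ q, 0 < σ q) (hσmono : Antitone σ)
    (u : Fin r → Fin m → ℝ) (v : Fin r → Fin n → ℝ)
    (hu : ∀ i j, u i ⬝ᵥ u j = if i = j then (1 : ℝ) else 0)
    (hv : ∀ i j, v i ⬝ᵥ v j = if i = j then (1 : ℝ) else 0)
    (hAv : ∀ q, A.mulVec (v q) = σ q • u q)
    (hAu : ∀ q, Aᵀ.mulVec (u q) = σ q • v q)
    (hA : A = ∑ q : Fin r, σ q • vecMulVec (u q) (v q))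
    (hk1 : 1 ≤ k) (hkr : k < r)
    (hgap : σ ⟨k, hkr⟩ < σ ⟨k - 1, by omega⟩)
    (B : Matrix (Fin m) (Fin n) ℝ) (hBrank : B.rank ≤ k)
    (hBopt : frobNorm (A - B) =
      Real.sqrt (∑ q ∈ Finset.univ.filter (fun q : Fin r => k ≤ (q : ℕ)), σ q ^ 2)) :
    B = ∑ q ∈ Finset.univ.filter (fun q : Fin r => (q : ℕ) < k),
      σ q • vecMulVec (u q) (v q) := by
  obtain ⟨P, hPt, hPP, hBP, htr⟩ := B.exists_rowSpace_projection
  set c : Fin r → ℝ := fun q => v q ⬝ᵥ P *ᵥ v q with hc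
  have hcP : ∀ q, c q = P *ᵥ v q ⬝ᵥ P *ᵥ v q := fun q =>
    dotProduct_mulVec_of_projection hPt hPP (v q)
  have hcQ : ∀ q, 1 - c q = (v q - P *ᵥ v q) ⬝ᵥ (v q - P *ᵥ v q) := by
    intro q
    have h1 : v q ⬝ᵥ v q = 1 := by simp [hv]
    have h2 : P *ᵥ v q ⬝ᵥ v q = c q := dotProduct_comm _ _
    rw [sub_dotProduct, dotProduct_sub, dotProduct_sub, h1, h2, ← hcP]
    simp [hc]
  have hc0 : ∀ q, 0 ≤ c q := fun q => by
    rw [hcP]; exact Finset.sum_nonneg fun i _ => mul_self_nonneg _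
  have hc1 : ∀ q, c q ≤ 1 := fun q => by
    rw [← sub_nonneg, hcQ]; exact Finset.sum_nonneg fun i _ => mul_self_nonneg _
  have hcsum : ∑ q, c q ≤ k := by
    refine (sum_dotProduct_mulVec_le_trace hPt hPP v hv).trans ?_
    rw [htr]
    exact_mod_cast hBrank
  have hgram : Aᵀ * A = ∑ q, σ q ^ 2 • vecMulVec (v q) (v q) := by
    have hmul := congrArg (Aᵀ * ·) hA
    simp only [Matrix.mul_sum] at hmul
    refine hmul.trans ?_
    refine Finset.sum_congr rfl fun q _ => ?_
    rw [Matrix.mul_smul, mul_vecMulVec, hAu, smul_vecMulVec, smul_smul, sq]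
  have hres : (Aᵀ * A * (1 - P)).trace = ∑ q, σ q ^ 2 * (1 - c q) := by
    rw [hgram, Matrix.sum_mul, trace_sum]
    refine Finset.sum_congr rfl fun q _ => ?_
    have h1 : v q ⬝ᵥ v q = 1 := by simp [hv]
    rw [Matrix.smul_mul, trace_smul, vecMulVec_mul, trace_vecMulVec, dotProduct_comm,
      ← dotProduct_mulVec, sub_mulVec, dotProduct_sub, one_mulVec, h1, smul_eq_mul]
  have hnorm : ∑ q ∈ Finset.univ.filter (fun q : Fin r => k ≤ (q : ℕ)), σ q ^ 2
      = ((A * P - B)ᵀ * (A * P - B)).trace + ∑ q, σ q ^ 2 * (1 - c q) := by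
    rw [← hres, ← trace_transpose_mul_self_sub A hPt hPP hBP]
    exact ((Real.sqrt_inj (trace_transpose_mul_self_nonneg _)
      (Finset.sum_nonneg fun q _ => sq_nonneg _)).1 hBopt).symm
  obtain ⟨hzero, hind⟩ := weights_eq_indicator_of_gap hkr.le (pow_pos (hσpos ⟨k, hkr⟩) 2)
    (fun q hq => pow_lt_pow_left₀
      (hgap.trans_le (hσmono (Fin.mk_le_mk.2 (by omega) : q ≤ ⟨k - 1, by omega⟩)))
      (hσpos _).le two_ne_zero)
    (fun q hq => pow_le_pow_left₀ (hσpos q).le (hσmono (Fin.mk_le_mk.2 hq : ⟨k, hkr⟩ ≤ q)) 2)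
    hc0 hc1 hcsum (trace_transpose_mul_self_nonneg _) hnorm
  have hBA : B = A * P := (sub_eq_zero.1 (trace_transpose_mul_self_eq_zero hzero)).symm
  rw [hBA, hA, Matrix.sum_mul, Finset.sum_filter]
  refine Finset.sum_congr rfl fun q _ => ?_
  rw [Matrix.smul_mul, vecMulVec_mul, ← mulVec_transpose, hPt]
  have hq := hind q
  split_ifs at hq ⊢ with hlt
  · have : v q - P *ᵥ v q = 0 := dotProduct_self_eq_zero.1 (by rw [← hcQ, hq, sub_self])
    rw [← sub_eq_zero.1 this]
  · have : P *ᵥ v q = 0 := dotProduct_self_eq_zero.1 (by rw [← hcP, hq])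
    ext i j
    simp [this, vecMulVec_apply]
end

section
/- Let A be a real m×n matrix, let k < p ≤ min(m, n), and let x_1, ..., x_p ∈ ℝ^m be an orthonormal set. Let S := ((Aᵀ x_i)ᵀ (Aᵀ x_j))_{i,j=1}^p, let o_1, ..., o_k ∈ ℝ^p be orthonormal eigenvectors of S corresponding to its k largest eigenvalues λ_1 ≥ ... ≥ λ_k, and define x̃_j = ∑_{i=1}^p (o_j)_i x_i for j = 1, ..., k. Then the updated k-rank approximation is at least as good as the previous one: ‖A − ∑_{i=1}^k x̃_i (Aᵀ x̃_i)ᵀ‖_F ≤ ‖A − ∑_{i=1}^k x_i (Aᵀ x_i)ᵀ‖_F, and consequently ‖∑_{i=1}^k x_i (Aᵀ x_i)ᵀ‖_F ≤ ‖∑_{i=1}^k x̃_i (Aᵀ x̃_i)ᵀ‖_F. -/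
open Matrix BigOperators

/-- The squared norm of `∑ᵢ yᵢ (Aᵀ yᵢ)ᵀ` for orthonormal `yᵢ`. -/
theorem trace_transpose_mul_sum_vecMulVec {ι m n : Type*} [Fintype ι] [DecidableEq ι]
    [Fintype m] [Fintype n] (A : Matrix m n ℝ) (y : ι → m → ℝ)
    (hy : ∀ i j, y i ⬝ᵥ y j = if i = j then (1 : ℝ) else 0) :
    trace ((∑ i, vecMulVec (y i) (Aᵀ *ᵥ y i))ᵀ * ∑ i, vecMulVec (y i) (Aᵀ *ᵥ y i)) =
      ∑ i, (Aᵀ *ᵥ y i) ⬝ᵥ (Aᵀ *ᵥ y i) := by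
  simp [transpose_sum, Matrix.sum_mul, Matrix.mul_sum, trace_sum, transpose_vecMulVec,
    vecMulVec_mul_vecMulVec, hy, trace_vecMulVec, ite_smul,
    apply_ite (dotProduct _)]

/-- The inner product of `A` with `∑ᵢ yᵢ (Aᵀ yᵢ)ᵀ`. -/
theorem trace_transpose_mul_sum_vecMulVec_self {ι m n : Type*} [Fintype ι]
    [Fintype m] [Fintype n] (A : Matrix m n ℝ) (y : ι → m → ℝ) :
    trace (Aᵀ * ∑ i, vecMulVec (y i) (Aᵀ *ᵥ y i)) =
      ∑ i, (Aᵀ *ᵥ y i) ⬝ᵥ (Aᵀ *ᵥ y i) := by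
  simp [Matrix.mul_sum, trace_sum, mul_vecMulVec, trace_vecMulVec]

/-- The squared residual norm of the projection of `A` onto the span of orthonormal `yᵢ`. -/
theorem trace_transpose_mul_sub_sum_vecMulVec {ι m n : Type*} [Fintype ι] [DecidableEq ι]
    [Fintype m] [Fintype n] (A : Matrix m n ℝ) (y : ι → m → ℝ)
    (hy : ∀ i j, y i ⬝ᵥ y j = if i = j then (1 : ℝ) else 0) :
    trace ((A - ∑ i, vecMulVec (y i) (Aᵀ *ᵥ y i))ᵀ *
        (A - ∑ i, vecMulVec (y i) (Aᵀ *ᵥ y i))) =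
      trace (Aᵀ * A) - ∑ i, (Aᵀ *ᵥ y i) ⬝ᵥ (Aᵀ *ᵥ y i) := by
  have h₁ := trace_transpose_mul_sum_vecMulVec A y hy
  have h₂ := trace_transpose_mul_sum_vecMulVec_self A y
  set M := ∑ i, vecMulVec (y i) (Aᵀ *ᵥ y i)
  have h₃ : trace (Mᵀ * A) = trace (Aᵀ * M) := by
    rw [← trace_transpose, transpose_mul, transpose_transpose]
  rw [transpose_sub, Matrix.sub_mul, Matrix.mul_sub, Matrix.mul_sub, trace_sub, trace_sub,
    trace_sub, h₃, h₁, h₂]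
  ring

/-- Weights in `[0, 1]` of total mass `k` give at most the sum of the `k` largest values. -/
theorem sum_mul_le_sum_castLE {p k : ℕ} (hkp : k < p) {lam : Fin p → ℝ} (hlam : Antitone lam)
    {w : Fin p → ℝ} (hw₀ : ∀ j, 0 ≤ w j) (hw₁ : ∀ j, w j ≤ 1) (hw : ∑ j, w j = k) :
    ∑ j, lam j * w j ≤ ∑ j : Fin k, lam (Fin.castLE hkp.le j) := by
  have hind (f : Fin p → ℝ) :
      ∑ j : Fin k, f (Fin.castLE hkp.le j) = ∑ j : Fin p, if (j : ℕ) < k then f j else 0 := by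
    rw [← Finset.sum_filter]
    refine Finset.sum_bij (fun j _ => Fin.castLE hkp.le j) (by simp)
      (fun _ _ _ _ h => Fin.castLE_injective hkp.le h) (fun j hj => ?_) (by simp)
    exact ⟨⟨j, by simpa using hj⟩, Finset.mem_univ _, rfl⟩
  have hk : ∑ j : Fin p, (if (j : ℕ) < k then (1 : ℝ) else 0) = k := by
    rw [← hind fun _ => 1]; simp
  set c := lam ⟨k, hkp⟩
  have key : ∑ j, (lam j - c) * (w j - if (j : ℕ) < k then (1 : ℝ) else 0) ≤ 0 := by
    refine Finset.sum_nonpos fun j _ => ?_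
    split_ifs with hj
    · exact mul_nonpos_of_nonneg_of_nonpos (sub_nonneg.2 (hlam (Fin.le_def.2 hj.le)))
        (sub_nonpos.2 (hw₁ j))
    · exact mul_nonpos_of_nonpos_of_nonneg
        (sub_nonpos.2 (hlam (Fin.le_def.2 (not_lt.1 hj)))) (by simpa using hw₀ j)
  have hexp : ∑ j, (lam j - c) * (w j - if (j : ℕ) < k then (1 : ℝ) else 0) =
      ∑ j, lam j * w j - (∑ j : Fin p, if (j : ℕ) < k then lam j else 0) -
        c * (∑ j, w j - ∑ j : Fin p, if (j : ℕ) < k then (1 : ℝ) else 0) := by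
    rw [← Finset.sum_sub_distrib, ← Finset.sum_sub_distrib, Finset.mul_sum,
      ← Finset.sum_sub_distrib]
    refine Finset.sum_congr rfl fun j _ => ?_
    split_ifs <;> ring
  rw [hind]
  rw [hexp, hw, hk] at key
  linarith

/-- Ky Fan: the first `k` diagonal entries sum to at most the `k` largest eigenvalues. -/
theorem sum_diag_le_sum_eigenvalues {p k : ℕ} (hkp : k < p) (S : Matrix (Fin p) (Fin p) ℝ)
    {lam : Fin p → ℝ} (hlam : Antitone lam) (o : Fin p → Fin p → ℝ)
    (ho : ∀ i j, o i ⬝ᵥ o j = if i = j then (1 : ℝ) else 0)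
    (hoeig : ∀ i, S *ᵥ o i = lam i • o i) :
    ∑ i : Fin k, S (Fin.castLE hkp.le i) (Fin.castLE hkp.le i) ≤
      ∑ i : Fin k, lam (Fin.castLE hkp.le i) := by
  have hO : of o * (of o)ᵀ = 1 := by
    ext i j
    simpa [mul_apply, one_apply, dotProduct] using ho i j
  have hO' : (of o)ᵀ * of o = 1 := mul_eq_one_comm.1 hO
  have hcol (a b : Fin p) : ∑ j, o j a * o j b = if a = b then (1 : ℝ) else 0 := by
    simpa [mul_apply, one_apply] using congr_fun₂ hO' a b
  have hrow (j : Fin p) : ∑ a, o j a ^ 2 = 1 := by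
    simpa [dotProduct, pow_two] using ho j j
  have hdiag (a : Fin p) : S a a = ∑ j, lam j * o j a ^ 2 := by
    calc S a a = ∑ b, S a b * ∑ j, o j b * o j a := by simp [hcol]
      _ = ∑ j, (S *ᵥ o j) a * o j a := by
        simp only [mulVec, dotProduct, Finset.mul_sum, Finset.sum_mul]
        rw [Finset.sum_comm]
        simp only [mul_assoc]
      _ = ∑ j, lam j * o j a ^ 2 := by
        simp [hoeig, pow_two, mul_assoc]
  simp only [hdiag]
  rw [Finset.sum_comm]
  simp only [← Finset.mul_sum]
  refine sum_mul_le_sum_castLE hkp hlam (fun j => by positivity) (fun j => ?_) ?_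
  · rw [← hrow j, ← Finset.sum_image (f := fun a => o j a ^ 2)
      (fun _ _ _ _ h => Fin.castLE_injective hkp.le h)]
    exact Finset.sum_le_sum_of_subset_of_nonneg (Finset.subset_univ _)
      fun _ _ _ => sq_nonneg _
  · rw [Finset.sum_comm]
    simp [pow_two, hcol]

/-- The updated `k`-rank approximation is at least as good as the previous one: with
`x 1, ..., x p` orthonormal (`k < p ≤ min m n`), `S = ((Aᵀ xᵢ)ᵀ (Aᵀ xⱼ))ᵢⱼ`,
eigenvalues `λ 0 ≥ ... ≥ λ (p-1)` of `S` with orthonormal eigenvectors `o i`, and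
`x̃ j = ∑ᵢ (o j)ᵢ • x i` (`j < k`), one has
`‖A − ∑_{i<k} x̃ᵢ (Aᵀ x̃ᵢ)ᵀ‖_F ≤ ‖A − ∑_{i<k} xᵢ (Aᵀ xᵢ)ᵀ‖_F` and
`‖∑_{i<k} xᵢ (Aᵀ xᵢ)ᵀ‖_F ≤ ‖∑_{i<k} x̃ᵢ (Aᵀ x̃ᵢ)ᵀ‖_F`. -/
theorem update_error_decreases (m n p k : ℕ) (hkp : k < p) (hp : p ≤ min m n)
    (A : Matrix (Fin m) (Fin n) ℝ)
    (x : Fin p → Fin m → ℝ)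
    (hx : ∀ i j, x i ⬝ᵥ x j = if i = j then (1 : ℝ) else 0)
    (S : Matrix (Fin p) (Fin p) ℝ)
    (hS : S = Matrix.of fun i j => (Aᵀ.mulVec (x i)) ⬝ᵥ (Aᵀ.mulVec (x j)))
    (lam : Fin p → ℝ) (hlam : Antitone lam)
    (o : Fin p → Fin p → ℝ)
    (ho : ∀ i j, o i ⬝ᵥ o j = if i = j then (1 : ℝ) else 0)
    (hoeig : ∀ i, S.mulVec (o i) = lam i • o i)
    (xt : Fin k → Fin m → ℝ)
    (hxt : ∀ j : Fin k, xt j = ∑ i : Fin p, o (Fin.castLE hkp.le j) i • x i) :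
    frobNorm (A - ∑ i : Fin k, vecMulVec (xt i) (Aᵀ.mulVec (xt i))) ≤
      frobNorm (A - ∑ i : Fin k,
        vecMulVec (x (Fin.castLE hkp.le i)) (Aᵀ.mulVec (x (Fin.castLE hkp.le i)))) ∧
    frobNorm (∑ i : Fin k,
        vecMulVec (x (Fin.castLE hkp.le i)) (Aᵀ.mulVec (x (Fin.castLE hkp.le i)))) ≤
      frobNorm (∑ i : Fin k, vecMulVec (xt i) (Aᵀ.mulVec (xt i))) := by
  have hinj := Fin.castLE_injective hkp.le
  have hxk (i j : Fin k) : x (Fin.castLE hkp.le i) ⬝ᵥ x (Fin.castLE hkp.le j) =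
      if i = j then (1 : ℝ) else 0 := by
    simp [hx, hinj.eq_iff]
  have hxtk (i j : Fin k) : xt i ⬝ᵥ xt j = if i = j then (1 : ℝ) else 0 := by
    have h := ho (Fin.castLE hkp.le i) (Fin.castLE hkp.le j)
    simp only [hinj.eq_iff] at h
    rw [← h, hxt, hxt]
    simp only [sum_dotProduct, dotProduct_sum, smul_dotProduct, dotProduct_smul, hx]
    simp [dotProduct, mul_comm]
  have hSe (a b : Fin p) : S a b = (Aᵀ *ᵥ x a) ⬝ᵥ (Aᵀ *ᵥ x b) := by
    rw [hS, of_apply]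
  have hSymm (a b : Fin p) : S a b = S b a := by
    rw [hSe, hSe, dotProduct_comm]
  have hval (j : Fin k) :
      (Aᵀ *ᵥ xt j) ⬝ᵥ (Aᵀ *ᵥ xt j) = lam (Fin.castLE hkp.le j) := by
    have h : o (Fin.castLE hkp.le j) ⬝ᵥ S *ᵥ o (Fin.castLE hkp.le j) =
        lam (Fin.castLE hkp.le j) := by
      rw [hoeig, dotProduct_smul, ho]
      simp
    rw [← h, hxt]
    simp only [mulVec_sum, mulVec_smul, sum_dotProduct, dotProduct_sum, smul_dotProduct,
      dotProduct_smul, smul_eq_mul, ← hSe]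
    simp only [dotProduct, mulVec, Finset.mul_sum]
    refine Finset.sum_congr rfl fun a _ => Finset.sum_congr rfl fun b _ => ?_
    rw [hSymm b a]
    ring
  have hle : ∑ i : Fin k, (Aᵀ *ᵥ x (Fin.castLE hkp.le i)) ⬝ᵥ (Aᵀ *ᵥ x (Fin.castLE hkp.le i)) ≤
      ∑ i : Fin k, (Aᵀ *ᵥ xt i) ⬝ᵥ (Aᵀ *ᵥ xt i) := by
    simpa only [hval, hSe] using sum_diag_le_sum_eigenvalues hkp S hlam o ho hoeig
  refine ⟨Real.sqrt_le_sqrt ?_, Real.sqrt_le_sqrt ?_⟩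
  · rw [trace_transpose_mul_sub_sum_vecMulVec A xt hxtk,
      trace_transpose_mul_sub_sum_vecMulVec A (fun i => x (Fin.castLE hkp.le i)) hxk]
    exact sub_le_sub_left hle _
  · rw [trace_transpose_mul_sum_vecMulVec A xt hxtk,
      trace_transpose_mul_sum_vecMulVec A (fun i => x (Fin.castLE hkp.le i)) hxk]
    exact hle
end
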